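/- For every nonnegative integer n, the number of partitions of 7n+5 is divisible by 7, i.e., p(7n+5) ≡ 0 (mod 7). -/

import Mathlib

section QAnalogues

variable {R S : Type*} [CommRing R] [CommRing S]

/-- The Gaussian binomial coefficient at `q`, defined by the `q`-Pascal rule. -/
def qBinom (q : R) : ℕ → ℕ → R
  | _, 0 => 1
  | 0, _ + 1 => 0
  | n + 1, k + 1 => qBinom q n k + q ^ (k + 1) * qBinom q n (k + 1)

/-- The `q`-Pochhammer symbol `(q; q)_n`. -/
def qPoch (q : R) (n : ℕ) : R := ∏ i ∈ Finset.range n, (1 - q ^ (i + 1))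

theorem qPoch_succ (q : R) (n : ℕ) : qPoch q (n + 1) = qPoch q n * (1 - q ^ (n + 1)) :=
  Finset.prod_range_succ _ _

@[simp]
theorem qBinom_zero_right (q : R) (n : ℕ) : qBinom q n 0 = 1 := by
  cases n <;> rfl

theorem qBinom_succ_succ (q : R) (n k : ℕ) :
    qBinom q (n + 1) (k + 1) = qBinom q n k + q ^ (k + 1) * qBinom q n (k + 1) := rfl

theorem qBinom_eq_zero_of_lt (q : R) {n k : ℕ} (h : n < k) : qBinom q n k = 0 := by
  induction n generalizing k with
  | zero => obtain ⟨k, rfl⟩ := Nat.exists_eq_add_one_of_ne_zero h.ne'; rfl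
  | succ n ih =>
    obtain ⟨k, rfl⟩ := Nat.exists_eq_add_one_of_ne_zero (Nat.ne_zero_of_lt h)
    rw [qBinom_succ_succ, ih (by omega), ih (by omega), mul_zero, add_zero]

@[simp]
theorem qBinom_self (q : R) (n : ℕ) : qBinom q n n = 1 := by
  induction n with
  | zero => rfl
  | succ n ih => rw [qBinom_succ_succ, ih, qBinom_eq_zero_of_lt q n.lt_succ_self]; ring

theorem map_qBinom (f : R →+* S) (q : R) (n k : ℕ) : f (qBinom q n k) = qBinom (f q) n k := by
  induction n generalizing k with
  | zero => cases k <;> simp [qBinom]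
  | succ n ih => cases k <;> simp [qBinom_succ_succ, ih]

theorem qBinom_mul_qPoch_mul_qPoch (q : R) (a b : ℕ) :
    qBinom q (a + b) a * qPoch q a * qPoch q b = qPoch q (a + b) := by
  induction a generalizing b with
  | zero => simp [qPoch]
  | succ a iha =>
    induction b with
    | zero => simp [qPoch]
    | succ b ihb =>
      have h₁ := iha (b + 1)
      rw [show a + 1 + b = a + b + 1 by ring, qPoch_succ q a] at ihb
      rw [show a + (b + 1) = a + b + 1 by ring, qPoch_succ q b] at h₁
      rw [show a + 1 + (b + 1) = a + b + 1 + 1 by ring, qBinom_succ_succ, qPoch_succ q a,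
        qPoch_succ q b, qPoch_succ q (a + b + 1)]
      linear_combination (1 - q ^ (a + 1)) * h₁ + q ^ (a + 1) * (1 - q ^ (b + 1)) * ihb

/-- The `q`-binomial theorem. -/
theorem prod_add_mul_pow_eq_sum_qBinom (q x y : R) (m : ℕ) :
    ∏ i ∈ Finset.range m, (y + x * q ^ i) =
      ∑ j ∈ Finset.range (m + 1), q ^ j.choose 2 * qBinom q m j * x ^ j * y ^ (m - j) := by
  induction m generalizing x with
  | zero => simp
  | succ m ih =>
    have hx : ∏ i ∈ Finset.range m, (y + x * q ^ (i + 1)) =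
        ∏ i ∈ Finset.range m, (y + (x * q) * q ^ i) :=
      Finset.prod_congr rfl fun i _ ↦ by ring
    rw [Finset.prod_range_succ', hx, ih, Finset.sum_range_succ' _ (m + 1), pow_zero, mul_one,
      mul_add]
    have hy : (∑ j ∈ Finset.range (m + 1),
        q ^ j.choose 2 * qBinom q m j * (x * q) ^ j * y ^ (m - j)) * y =
        ∑ j ∈ Finset.range (m + 1),
          q ^ (j + 1).choose 2 * q ^ (j + 1) * qBinom q m (j + 1) * x ^ (j + 1) * y ^ (m - j) +
        y ^ (m + 1) := by
      rw [Finset.sum_range_succ', Finset.sum_range_succ, qBinom_eq_zero_of_lt q m.lt_succ_self,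
        add_mul, Finset.sum_mul]
      simp only [mul_zero, zero_mul, add_zero]
      congr 1
      · refine Finset.sum_congr rfl fun j hj ↦ ?_
        rw [Finset.mem_range] at hj
        rw [show m - j = m - (j + 1) + 1 by omega]
        ring
      · simp [pow_succ]
    rw [hy, Finset.sum_mul, add_right_comm, ← Finset.sum_add_distrib]
    congr 1
    · refine Finset.sum_congr rfl fun j _ ↦ ?_
      rw [Nat.add_sub_add_right, qBinom_succ_succ, Nat.choose_succ_succ' j 1, Nat.choose_one_right]
      ring
    · simp

theorem prod_pow_sub_pow (q : R) (n : ℕ) :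
    ∏ i ∈ Finset.range n, (q ^ n - q ^ i) = (-1) ^ n * q ^ n.choose 2 * qPoch q n := by
  have h : ∀ i ∈ Finset.range n, q ^ n - q ^ i = (-1) * q ^ i * (1 - q ^ (n - 1 - i + 1)) := by
    intro i hi
    rw [Finset.mem_range] at hi
    rw [show n - 1 - i + 1 = n - i by omega]
    have : q ^ n = q ^ i * q ^ (n - i) := by rw [← pow_add, Nat.add_sub_cancel' hi.le]
    rw [this]; ring
  rw [Finset.prod_congr rfl h, Finset.prod_mul_distrib, Finset.prod_mul_distrib,
    Finset.prod_range_reflect (fun i ↦ 1 - q ^ (i + 1)), Finset.prod_pow_eq_pow_sum,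
    Finset.sum_range_id, Nat.choose_two_right, qPoch]
  simp

open Polynomial in
/-- The derivative at `z = 1` of the `q`-binomial theorem for
`∏ i < 2n + 1, (q ^ n - z q ^ i)`. -/
theorem pow_mul_qPoch_sq_eq_sum (q : R) (n : ℕ) :
    (-1) ^ (n + 1) * q ^ (n.choose 2 + n + n * n) * qPoch q n ^ 2 =
      ∑ j ∈ Finset.range (2 * n + 2),
        (-1) ^ j * j * q ^ (j.choose 2 + n * (2 * n + 1 - j)) * qBinom q (2 * n + 1) j := by
  have key := congr_arg (fun p : R[X] ↦ (derivative p).eval 1)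
    (prod_add_mul_pow_eq_sum_qBinom (C q) (-X) (C q ^ n) (2 * n + 1))
  have hl : ∏ i ∈ Finset.range (2 * n + 1), (C q ^ n + -X * C q ^ i) =
      (1 - X) * (C q ^ n * (∏ i ∈ Finset.range n, (C q ^ n + -X * C q ^ i)) *
        ∏ i ∈ Finset.range n, (C q ^ n + -X * C q ^ (n + 1 + i))) := by
    rw [show 2 * n + 1 = n + 1 + n by ring, Finset.prod_range_add, Finset.prod_range_succ]
    ring
  have hr : ∏ i ∈ Finset.range n, (q ^ n - q ^ (n + 1 + i)) = q ^ (n * n) * qPoch q n := by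
    have h : ∀ i ∈ Finset.range n, q ^ n - q ^ (n + 1 + i) = q ^ n * (1 - q ^ (i + 1)) :=
      fun i _ ↦ by ring
    rw [Finset.prod_congr rfl h, Finset.prod_mul_distrib, qPoch, pow_mul]
    simp
  simp only [hl, ← map_qBinom C] at key
  simp only [derivative_mul, derivative_sum, eval_finsetSum, eval_add, eval_mul, eval_prod] at key
  simp [← sub_eq_add_neg, prod_pow_sub_pow, hr, derivative_pow] at key
  calc
    _ = -(q ^ n * ((-1) ^ n * q ^ n.choose 2 * qPoch q n) * (q ^ (n * n) * qPoch q n)) := by ring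
    _ = _ := by
      rw [key, ← Finset.sum_neg_distrib]
      refine Finset.sum_congr rfl fun j _ ↦ ?_
      rcases j with _ | j
      · simp
      · rw [Nat.add_sub_cancel]
        ring

end QAnalogues

namespace PowerSeries

variable (R : Type*) [CommRing R]

theorem isUnit_qPoch_X (n : ℕ) : IsUnit (qPoch (X : R⟦X⟧) n) := by
  rw [isUnit_iff_constantCoeff]
  simp [qPoch]

theorem qBinom_X_symm_add (a b : ℕ) : qBinom (X : R⟦X⟧) (a + b) a = qBinom X (a + b) b := by
  have h := qBinom_mul_qPoch_mul_qPoch (X : R⟦X⟧) b a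
  rw [add_comm b a, ← qBinom_mul_qPoch_mul_qPoch (X : R⟦X⟧) a b, mul_right_comm] at h
  exact ((isUnit_qPoch_X R a).mul_right_cancel ((isUnit_qPoch_X R b).mul_right_cancel h)).symm

/-- A finite form of Jacobi's identity. -/
theorem qPoch_X_sq_eq_sum (n : ℕ) :
    qPoch (X : R⟦X⟧) n ^ 2 = ∑ k ∈ Finset.range (n + 1),
      (-1) ^ k * (2 * (k : R⟦X⟧) + 1) * X ^ (k + 1).choose 2 * qBinom X (2 * n + 1) (n - k) := by
  have key := pow_mul_qPoch_sq_eq_sum (X : R⟦X⟧) n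
  rw [show 2 * n + 2 = n + 1 + (n + 1) by ring, Finset.sum_range_add,
    ← Finset.sum_range_reflect _ (n + 1), ← Finset.sum_add_distrib] at key
  have hterm : ∀ k ∈ Finset.range (n + 1),
      (-1) ^ (n + 1 - 1 - k) * ((n + 1 - 1 - k : ℕ) : R⟦X⟧) *
          X ^ ((n + 1 - 1 - k).choose 2 + n * (2 * n + 1 - (n + 1 - 1 - k))) *
          qBinom X (2 * n + 1) (n + 1 - 1 - k) +
        (-1) ^ (n + 1 + k) * ((n + 1 + k : ℕ) : R⟦X⟧) *
          X ^ ((n + 1 + k).choose 2 + n * (2 * n + 1 - (n + 1 + k))) *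
          qBinom X (2 * n + 1) (n + 1 + k) =
      X ^ (n.choose 2 + n + n * n) * ((-1) ^ (n + 1) * ((-1) ^ k * (2 * (k : R⟦X⟧) + 1) *
        X ^ (k + 1).choose 2 * qBinom X (2 * n + 1) (n - k))) := by
    intro k hk
    obtain ⟨d, rfl⟩ := Nat.exists_eq_add_of_le (Finset.mem_range_succ_iff.mp hk)
    have hsymm := qBinom_X_symm_add R d (2 * k + d + 1)
    rw [show d + (2 * k + d + 1) = 2 * (k + d) + 1 by ring] at hsymm
    rw [show k + d + 1 - 1 - k = d by omega, show k + d - k = d by omega,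
      show k + d + 1 + k = 2 * k + d + 1 by ring,
      show 2 * (k + d) + 1 - d = 2 * k + d + 1 by omega,
      show 2 * (k + d) + 1 - (2 * k + d + 1) = d by omega, ← hsymm]
    have h₁ : d.choose 2 + (k + d) * (2 * k + d + 1) =
        (k + d).choose 2 + (k + d) + (k + d) * (k + d) + (k + 1).choose 2 := by
      qify
      simp only [Nat.cast_choose_two]
      push_cast
      ring
    have h₂ : (2 * k + d + 1).choose 2 + (k + d) * d =
        (k + d).choose 2 + (k + d) + (k + d) * (k + d) + (k + 1).choose 2 := by
      qify
      simp only [Nat.cast_choose_two]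
      push_cast
      ring
    have h₃ : (-1 : R⟦X⟧) ^ (k + d + 1) * (-1) ^ k = -(-1) ^ d := by
      rw [← pow_add, show k + d + 1 + k = 2 * k + (d + 1) by ring, pow_add, pow_mul]
      simp [pow_succ]
    have h₄ : (-1 : R⟦X⟧) ^ (2 * k + d + 1) = -(-1) ^ d := by
      rw [show 2 * k + d + 1 = 2 * k + (d + 1) by ring, pow_add, pow_mul]
      simp [pow_succ]
    rw [h₁, h₂, h₄, pow_add X _ ((k + 1).choose 2)]
    push_cast
    linear_combination (-(X : R⟦X⟧) ^ ((k + d).choose 2 + (k + d) + (k + d) * (k + d)) *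
      (2 * (k : R⟦X⟧) + 1) * X ^ (k + 1).choose 2 * qBinom X (2 * (k + d) + 1) d) * h₃
  rw [Finset.sum_congr rfl hterm, ← Finset.mul_sum, ← Finset.mul_sum, mul_right_comm,
    mul_comm _ (X ^ _)] at key
  have h := X_pow_mul_cancel key
  exact (isUnit_one.neg.pow (n + 1)).mul_left_cancel h

theorem X_pow_dvd_pentagonalSeries_sub_qPoch {N m : ℕ} (h : N ≤ m) :
    X ^ N ∣ pentagonalSeries R - qPoch X m := by
  have hstep : ∀ l, X ^ N ∣ qPoch (X : R⟦X⟧) (m + l) - qPoch X m := by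
    intro l
    induction l with
    | zero => simp
    | succ l ih =>
      rw [← add_assoc, qPoch_succ, mul_sub, mul_one, sub_right_comm]
      exact dvd_sub ih ((pow_dvd_pow X (by omega)).mul_left _)
  rw [X_pow_dvd_iff]
  intro d hd
  obtain ⟨l, hl⟩ := ((Filter.tendsto_finset_range.comp (Filter.tendsto_add_atTop_nat m)).eventually
    (coeff_prod_one_sub_X_pow_eventually_eq R d)).exists
  rw [map_sub, ← hl, ← map_sub, Function.comp_apply, add_comm l m]
  exact X_pow_dvd_iff.mp (hstep l) d hd

/-- **Jacobi's identity** for the cube of `∏ (1 - X ^ n)`, as a congruence modulo `X ^ N`. -/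
theorem X_pow_dvd_pentagonalSeries_cube_sub (N : ℕ) :
    X ^ N ∣ pentagonalSeries R ^ 3 - ∑ k ∈ Finset.range (2 * N + 1),
      (-1) ^ k * (2 * (k : R⟦X⟧) + 1) * X ^ (k + 1).choose 2 := by
  let π := Ideal.Quotient.mk (Ideal.span {(X : R⟦X⟧) ^ N})
  have hπ : ∀ m, N ≤ m → π (qPoch X m) = π (pentagonalSeries R) := fun m hm ↦
    (Ideal.Quotient.mk_eq_mk_iff_sub_mem _ _).mpr (Ideal.mem_span_singleton.mpr
      ((dvd_sub_comm).mp (X_pow_dvd_pentagonalSeries_sub_qPoch R hm)))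
  have hu : IsUnit (π (pentagonalSeries R)) :=
    hπ N le_rfl ▸ (isUnit_qPoch_X R N).map π
  rw [← Ideal.mem_span_singleton, ← Ideal.Quotient.mk_eq_mk_iff_sub_mem]
  change π _ = π _
  have hbinom : ∀ a b, N ≤ a → N ≤ b → π (qBinom X (a + b) a) * π (pentagonalSeries R) = 1 := by
    intro a b ha hb
    have h := congr_arg π (qBinom_mul_qPoch_mul_qPoch (X : R⟦X⟧) a b)
    rw [map_mul, map_mul, hπ a ha, hπ b hb, hπ (a + b) (by omega)] at h
    exact hu.mul_right_cancel (h.trans (one_mul _).symm)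
  rw [pow_succ, map_mul, map_pow, ← hπ (2 * N) (by omega), ← map_pow, qPoch_X_sq_eq_sum,
    hπ (2 * N) (by omega), map_sum, map_sum, Finset.sum_mul]
  refine Finset.sum_congr rfl fun k hk ↦ ?_
  rw [Finset.mem_range_succ_iff] at hk
  rw [map_mul, mul_assoc]
  rcases le_total k N with hkN | hkN
  · have h := hbinom (2 * N - k) (2 * N + k + 1) (by omega) (by omega)
    rw [show 2 * N - k + (2 * N + k + 1) = 2 * (2 * N) + 1 by omega] at h
    rw [h, mul_one]
  · have h : π (X ^ (k + 1).choose 2) = 0 := by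
      refine Ideal.Quotient.eq_zero_iff_mem.mpr (Ideal.mem_span_singleton.mpr (pow_dvd_pow X ?_))
      rw [Nat.choose_succ_succ' k 1, Nat.choose_one_right]
      omega
    rw [map_mul, h, mul_zero, zero_mul]

theorem exists_of_coeff_pentagonalSeries_cube_ne_zero {m : ℕ}
    (h : coeff m (pentagonalSeries R ^ 3) ≠ 0) :
    ∃ k : ℕ, m = (k + 1).choose 2 ∧ 2 * (k : R) + 1 ≠ 0 := by
  have hJ := X_pow_dvd_iff.mp (X_pow_dvd_pentagonalSeries_cube_sub R (m + 1)) m m.lt_succ_self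
  rw [map_sub, sub_eq_zero] at hJ
  rw [hJ, map_sum] at h
  obtain ⟨k, -, hk⟩ := Finset.exists_ne_zero_of_sum_ne_zero h
  have hC : (-1) ^ k * (2 * (k : R⟦X⟧) + 1) = C ((-1) ^ k * (2 * (k : R) + 1)) := by
    simp [map_ofNat C]
  rw [hC, coeff_C_mul, coeff_X_pow] at hk
  refine ⟨k, ?_, ?_⟩
  · by_contra hm
    simp [hm] at hk
  · intro h0
    simp [h0] at hk

open WithPiTopology in
/-- Euler's product formula for the generating function of the partition numbers. -/
theorem mk_card_partition_mul_pentagonalSeries :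
    (mk fun n ↦ (Fintype.card n.Partition : R)) * pentagonalSeries R = 1 := by
  let : TopologicalSpace R := ⊥
  have : DiscreteTopology R := ⟨rfl⟩
  have h := (Nat.Partition.hasProd_powerSeriesMk_card_restricted R fun _ ↦ True).mul
    (hasProd_one_sub_X_pow R)
  have hone : ∀ i : ℕ, (∑' j : ℕ, (X : R⟦X⟧) ^ ((i + 1) * j)) * (1 - X ^ (i + 1)) = 1 := by
    intro i
    simp_rw [pow_mul]
    exact tsum_pow_mul_one_sub_of_constantCoeff_eq_zero (by simp)
  simp only [if_true, hone] at h
  simpa [Nat.Partition.restricted] using h.unique hasProd_one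

end PowerSeries

open PowerSeries

theorem coeff_pentagonalSeries_pow_six_zmod_seven {m : ℕ} (hm : m % 7 = 5) :
    coeff m (pentagonalSeries (ZMod 7) ^ 6) = 0 := by
  rw [show 6 = 3 + 3 by rfl, pow_add, coeff_mul]
  refine Finset.sum_eq_zero fun ⟨a, b⟩ hab ↦ ?_
  by_contra h
  obtain ⟨k, rfl, hk⟩ :=
    exists_of_coeff_pentagonalSeries_cube_ne_zero (ZMod 7) (left_ne_zero_of_mul h)
  obtain ⟨l, rfl, hl⟩ :=
    exists_of_coeff_pentagonalSeries_cube_ne_zero (ZMod 7) (right_ne_zero_of_mul h)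
  have htri : ∀ j : ℕ, 2 * (j + 1).choose 2 = (j + 1) * j := fun j ↦ by
    qify
    rw [Nat.cast_choose_two]
    push_cast
    ring
  have hsum : (m : ZMod 7) = 5 := by
    rw [← ZMod.natCast_mod, hm]
    rfl
  have hkl : ((k + 1) * k + (l + 1) * l : ZMod 7) = 2 * 5 := by
    rw [← hsum, ← Finset.HasAntidiagonal.mem_antidiagonal.mp hab]
    have hk2 := congr_arg (Nat.cast : ℕ → ZMod 7) (htri k)
    have hl2 := congr_arg (Nat.cast : ℕ → ZMod 7) (htri l)
    push_cast at hk2 hl2 ⊢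
    rw [← hk2, ← hl2]
    ring
  have hdec : ∀ x y : ZMod 7, 2 * x + 1 ≠ 0 → 2 * y + 1 ≠ 0 →
      (x + 1) * x + (y + 1) * y ≠ 2 * 5 := by decide
  exact hdec k l hk hl hkl

theorem coeff_eq_zero_of_mul_pentagonalSeries_eq_one {P : (ZMod 7)⟦X⟧}
    (hP : P * pentagonalSeries (ZMod 7) = 1) {m : ℕ} (hm : m % 7 = 5) : coeff m P = 0 := by
  have : Fact (Nat.Prime 7) := ⟨by norm_num⟩
  have hfrob : expand 7 (Nat.succ_ne_zero 6) P = P ^ 7 := by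
    have h := MvPowerSeries.map_frobenius_expand 7 (Nat.succ_ne_zero 6) (f := P)
    rw [ZMod.frobenius_zmod] at h
    rw [expand, ← h, MvPowerSeries.map_id]
    rfl
  have hfactor : P = pentagonalSeries (ZMod 7) ^ 6 * expand 7 (Nat.succ_ne_zero 6) P := by
    rw [hfrob, pow_succ P 6, ← mul_assoc, ← mul_pow, mul_comm (pentagonalSeries _) P, hP, one_pow,
      one_mul]
  rw [hfactor, coeff_mul]
  refine Finset.sum_eq_zero fun ⟨a, b⟩ hab ↦ ?_
  rw [Finset.HasAntidiagonal.mem_antidiagonal] at hab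
  by_cases hb : 7 ∣ b
  · rw [coeff_pentagonalSeries_pow_six_zmod_seven (by omega), zero_mul]
  · rw [coeff_expand_of_not_dvd _ _ _ hb, mul_zero]

/-- **Ramanujan's congruence modulo 7**: for every nonnegative integer `n`,
the number of partitions of `7 * n + 5` is divisible by `7`. -/
theorem ramanujan_congruence_mod_seven (n : ℕ) :
    7 ∣ Fintype.card (Nat.Partition (7 * n + 5)) := by
  rw [← ZMod.natCast_eq_zero_iff]
  have h := coeff_eq_zero_of_mul_pentagonalSeries_eq_one
    (mk_card_partition_mul_pentagonalSeries (ZMod 7)) (m := 7 * n + 5) (by omega)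
  rwa [coeff_mk] at h
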